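/- Define E(u) = 2∫₀^u e^{-πω²} dω for u ∈ ℝ and, for u ≠ 0, M(u) = (i/π) ∫_{ℝ - iu} e^{-πω² - 2πiuω}/ω dω (integral over the horizontal line Im(ω) = -u). Then for all nonzero real u, M(u) = E(u) - sgn(u). -/

import Mathlib

open Real Complex MeasureTheory

lemma integral_Ioi_one_mul_exp {a : ℝ} (ha : 0 < a) :
    ∫ v in Set.Ioi (1 : ℝ), 2 * π * v * Real.exp (-π * a * v ^ 2) = Real.exp (-π * a) / a := by
  have hderiv : ∀ v ∈ Set.Ici (1 : ℝ), HasDerivAt (fun v : ℝ => -(Real.exp (-π * a * v ^ 2) / a))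
      (2 * π * v * Real.exp (-π * a * v ^ 2)) v := by
    intro v _
    have h := ((((hasDerivAt_id v).pow 2).const_mul (-π * a)).exp.div_const a).neg
    convert! h using 1
    simp
    field_simp
  have hlim : Filter.Tendsto (fun v : ℝ => -(Real.exp (-π * a * v ^ 2) / a)) Filter.atTop
      (nhds 0) := by
    have h : Filter.Tendsto (fun v : ℝ => -π * a * v ^ 2) Filter.atTop Filter.atBot :=
      (Filter.tendsto_pow_atTop two_ne_zero).const_mul_atTop_of_neg
        (by have := mul_pos pi_pos ha; linarith)
    simpa using ((Real.tendsto_exp_atBot.comp h).div_const a).neg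
  rw [integral_Ioi_of_hasDerivAt_of_nonneg' hderiv _ hlim]
  · simp
  · intro v hv
    have : (0 : ℝ) < v := lt_trans one_pos hv
    positivity

lemma integral_mul_exp_sq_add_sq (u : ℝ) {v : ℝ} (hv : 0 < v) :
    ∫ t : ℝ, 2 * π * v * Real.exp (-π * (t ^ 2 + u ^ 2) * v ^ 2)
      = 2 * π * Real.exp (-(π * u ^ 2) * v ^ 2) := by
  have h (t : ℝ) : 2 * π * v * Real.exp (-π * (t ^ 2 + u ^ 2) * v ^ 2)
      = 2 * π * v * Real.exp (-(π * u ^ 2) * v ^ 2) * Real.exp (-(π * v ^ 2) * t ^ 2) := by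
    rw [mul_assoc (2 * π * v), ← Real.exp_add]
    ring_nf
  simp_rw [h]
  rw [integral_const_mul, integral_gaussian, ← div_div, div_self pi_ne_zero, Real.sqrt_div one_pos.le,
    Real.sqrt_sq hv.le]
  simp
  field_simp

lemma integral_exp_div_sq_add_sq {u : ℝ} (hu : 0 < u) :
    ∫ t : ℝ, Real.exp (-π * (t ^ 2 + u ^ 2)) / (t ^ 2 + u ^ 2)
      = ∫ v in Set.Ioi (1 : ℝ), 2 * π * Real.exp (-(π * u ^ 2) * v ^ 2) := by
  have hinner : ∀ v ∈ Set.Ioi (1 : ℝ),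
      ∫ t : ℝ, 2 * π * v * Real.exp (-π * (t ^ 2 + u ^ 2) * v ^ 2)
        = 2 * π * Real.exp (-(π * u ^ 2) * v ^ 2) :=
    fun v hv => integral_mul_exp_sq_add_sq u (lt_trans one_pos hv)
  have houter (t : ℝ) : Real.exp (-π * (t ^ 2 + u ^ 2)) / (t ^ 2 + u ^ 2)
      = ∫ v in Set.Ioi (1 : ℝ), 2 * π * v * Real.exp (-π * (t ^ 2 + u ^ 2) * v ^ 2) :=
    (integral_Ioi_one_mul_exp (by positivity)).symm
  simp_rw [houter]
  rw [integral_integral_swap, setIntegral_congr_fun measurableSet_Ioi hinner]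
  rw [integrable_prod_iff' (Continuous.aestronglyMeasurable (by fun_prop))]
  constructor
  · filter_upwards [ae_restrict_mem measurableSet_Ioi] with v hv
    have hv0 : 0 < v := lt_trans one_pos hv
    refine Integrable.of_integral_ne_zero ?_
    simp only [Function.uncurry_apply_pair]
    rw [hinner v hv]
    positivity
  · have hint : Integrable (fun v : ℝ => 2 * π * Real.exp (-(π * u ^ 2) * v ^ 2))
        (volume.restrict (Set.Ioi 1)) :=
      ((integrable_exp_neg_mul_sq (by positivity)).const_mul _).restrict
    refine hint.congr ?_
    filter_upwards [ae_restrict_mem measurableSet_Ioi] with v hv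
    have hv0 : 0 < v := lt_trans one_pos hv
    rw [← hinner v hv]
    refine integral_congr_ae (Filter.Eventually.of_forall fun t => ?_)
    simp only [Function.uncurry_apply_pair]
    rw [Real.norm_of_nonneg (by positivity)]

lemma mul_integral_exp_div_sq_add_sq_of_pos {u : ℝ} (hu : 0 < u) :
    u * ∫ t : ℝ, Real.exp (-π * (t ^ 2 + u ^ 2)) / (t ^ 2 + u ^ 2)
      = π * (1 - 2 * ∫ t in (0 : ℝ)..u, Real.exp (-π * t ^ 2)) := by
  have hint : Integrable (fun t : ℝ => Real.exp (-π * t ^ 2)) := integrable_exp_neg_mul_sq pi_pos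
  have hsplit := intervalIntegral.integral_interval_add_Ioi (a := 0) (b := u)
    hint.integrableOn hint.integrableOn
  rw [integral_gaussian_Ioi, div_self pi_ne_zero, Real.sqrt_one] at hsplit
  have hscale := integral_comp_mul_left_Ioi (fun t : ℝ => Real.exp (-π * t ^ 2)) 1 hu
  rw [mul_one, smul_eq_mul] at hscale
  have hsq (v : ℝ) : -(π * u ^ 2) * v ^ 2 = -π * (u * v) ^ 2 := by ring
  rw [integral_exp_div_sq_add_sq hu, integral_const_mul]
  simp_rw [hsq]
  rw [hscale, eq_sub_of_add_eq' hsplit]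
  field_simp

lemma mul_integral_exp_div_sq_add_sq {u : ℝ} (hu : u ≠ 0) :
    u * ∫ t : ℝ, Real.exp (-π * (t ^ 2 + u ^ 2)) / (t ^ 2 + u ^ 2)
      = π * (Real.sign u - 2 * ∫ t in (0 : ℝ)..u, Real.exp (-π * t ^ 2)) := by
  rcases hu.lt_or_gt with h | h
  · have hpos := mul_integral_exp_div_sq_add_sq_of_pos (neg_pos.mpr h)
    have hrefl := intervalIntegral.integral_comp_neg (a := 0) (b := -u)
      (fun t : ℝ => Real.exp (-π * t ^ 2))
    simp only [even_two, Even.neg_pow, neg_neg, neg_zero] at hrefl hpos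
    rw [hrefl, intervalIntegral.integral_symm] at hpos
    rw [Real.sign_of_neg h]
    linarith
  · rw [Real.sign_of_pos h, mul_integral_exp_div_sq_add_sq_of_pos h]

lemma integral_exp_div_sub_I_mul {u : ℝ} (hu : u ≠ 0) :
    ∫ t : ℝ, ((Real.exp (-π * (t ^ 2 + u ^ 2)) : ℝ) : ℂ) / ((t : ℂ) - Complex.I * (u : ℂ))
      = Complex.I * (u : ℂ) *
        ((∫ t : ℝ, Real.exp (-π * (t ^ 2 + u ^ 2)) / (t ^ 2 + u ^ 2) : ℝ) : ℂ) := by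
  have hu2 : 0 < u ^ 2 := by positivity
  have hpos (t : ℝ) : 0 < t ^ 2 + u ^ 2 := by positivity
  have hbound (t : ℝ) : Real.exp (-π * (t ^ 2 + u ^ 2)) / (t ^ 2 + u ^ 2)
      ≤ (u ^ 2)⁻¹ * Real.exp (-π * t ^ 2) := by
    rw [div_eq_inv_mul]
    refine mul_le_mul (inv_anti₀ hu2 (by nlinarith [sq_nonneg t]))
      (Real.exp_le_exp.mpr (by nlinarith [mul_pos pi_pos hu2])) (Real.exp_pos _).le
      (by positivity)
  have hcont : Continuous fun t : ℝ => Real.exp (-π * (t ^ 2 + u ^ 2)) / (t ^ 2 + u ^ 2) :=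
    Continuous.div (by fun_prop) (by fun_prop) fun t => (hpos t).ne'
  have heven : Integrable fun t : ℝ => Real.exp (-π * (t ^ 2 + u ^ 2)) / (t ^ 2 + u ^ 2) := by
    refine ((integrable_exp_neg_mul_sq pi_pos).const_mul (u ^ 2)⁻¹).mono'
      hcont.aestronglyMeasurable (Filter.Eventually.of_forall fun t => ?_)
    rw [Real.norm_of_nonneg (by have := hpos t; positivity)]
    exact hbound t
  have hodd : Integrable fun t : ℝ =>
      t * (Real.exp (-π * (t ^ 2 + u ^ 2)) / (t ^ 2 + u ^ 2)) := by
    refine ((integrable_mul_exp_neg_mul_sq pi_pos).norm.const_mul (u ^ 2)⁻¹).mono'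
      (continuous_id.mul hcont).aestronglyMeasurable (Filter.Eventually.of_forall fun t => ?_)
    rw [norm_mul, norm_mul, Real.norm_of_nonneg (Real.exp_pos (-π * t ^ 2)).le,
      Real.norm_of_nonneg (by have := hpos t; positivity :
        0 ≤ Real.exp (-π * (t ^ 2 + u ^ 2)) / (t ^ 2 + u ^ 2)), mul_left_comm]
    exact mul_le_mul_of_nonneg_left (hbound t) (norm_nonneg t)
  have hzero : ∫ t : ℝ, t * (Real.exp (-π * (t ^ 2 + u ^ 2)) / (t ^ 2 + u ^ 2)) = 0 := by
    have h := integral_neg_eq_self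
      (fun t : ℝ => t * (Real.exp (-π * (t ^ 2 + u ^ 2)) / (t ^ 2 + u ^ 2))) volume
    simp only [even_two, Even.neg_pow, neg_mul, integral_neg] at h ⊢
    linarith
  have hsplit (t : ℝ) :
      ((Real.exp (-π * (t ^ 2 + u ^ 2)) : ℝ) : ℂ) / ((t : ℂ) - Complex.I * (u : ℂ))
      = ((t * (Real.exp (-π * (t ^ 2 + u ^ 2)) / (t ^ 2 + u ^ 2)) : ℝ) : ℂ)
        + Complex.I * (u : ℂ) *
          ((Real.exp (-π * (t ^ 2 + u ^ 2)) / (t ^ 2 + u ^ 2) : ℝ) : ℂ) := by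
    have hne : (t : ℂ) - Complex.I * (u : ℂ) ≠ 0 := fun h => hu (by
      simpa using congrArg Complex.im h)
    have hne2 : (t : ℂ) ^ 2 + (u : ℂ) ^ 2 ≠ 0 := by exact_mod_cast (hpos t).ne'
    generalize Real.exp (-π * (t ^ 2 + u ^ 2)) = e
    push_cast
    field_simp
    linear_combination (e : ℂ) * (u : ℂ) ^ 2 * Complex.I_sq
  simp_rw [hsplit]
  rw [integral_add hodd.ofReal (heven.ofReal.const_mul _), integral_const_mul,
    integral_complex_ofReal, integral_complex_ofReal, hzero]
  simp

theorem M_eq_E_sub_sgn (u : ℝ) (hu : u ≠ 0) :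
    (Complex.I / (π : ℂ)) *
      (∫ t : ℝ, Complex.exp (-(π : ℂ) * ((t : ℂ) - Complex.I * (u : ℂ))^2
          - 2 * (π : ℂ) * Complex.I * (u : ℂ) * ((t : ℂ) - Complex.I * (u : ℂ)))
        / ((t : ℂ) - Complex.I * (u : ℂ)))
    = ((2 * ∫ t in (0:ℝ)..u, Real.exp (-π * t^2) : ℝ) : ℂ) - ((Real.sign u : ℝ) : ℂ) := by
  have hexp (t : ℝ) : Complex.exp (-(π : ℂ) * ((t : ℂ) - Complex.I * (u : ℂ))^2
        - 2 * (π : ℂ) * Complex.I * (u : ℂ) * ((t : ℂ) - Complex.I * (u : ℂ)))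
      = ((Real.exp (-π * (t ^ 2 + u ^ 2)) : ℝ) : ℂ) := by
    push_cast
    congr 1
    linear_combination (π : ℂ) * (u : ℂ) ^ 2 * Complex.I_sq
  have hpi : (π : ℂ) ≠ 0 := by exact_mod_cast pi_ne_zero
  simp_rw [hexp]
  rw [integral_exp_div_sub_I_mul hu, mul_assoc Complex.I, ← Complex.ofReal_mul,
    mul_integral_exp_div_sq_add_sq hu, Complex.ofReal_mul, Complex.ofReal_sub]
  generalize 2 * ∫ t in (0:ℝ)..u, Real.exp (-π * t^2) = E
  field_simp
  linear_combination (((Real.sign u : ℝ) : ℂ) - (E : ℂ)) * Complex.I_sq
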